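/- arXiv:2301.00639 — 2 statements merged into one kernel-verified Lean document; each statement's English description precedes it below -/
import Mathlib

section
/- Let V be an n-dimensional real inner product space with n ≥ 2, and let K be a symmetric bilinear form on V. Suppose that for every orthonormal family (e₁, ..., e_{n−1}) of n−1 vectors in V one has Σ_{j=1}^{n−1} K(e_j, e_j) ≤ −(n−1), and suppose in addition that for some orthonormal basis (e₁, ..., eₙ) of V one has Σ_{i=1}^{n} K(e_i, e_i) = −n (i.e., tr K = −n). Then K(v, w) = −⟨v, w⟩ for all v, w ∈ V, i.e., K = −g. -/
open RealInnerProductSpace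

/-- The trace of a bilinear form does not depend on the orthonormal basis. -/
theorem OrthonormalBasis.sum_bilin_apply_self_eq
    {V ι κ : Type*} [NormedAddCommGroup V] [InnerProductSpace ℝ V] [FiniteDimensional ℝ V]
    [Fintype ι] [Fintype κ] (K : V →ₗ[ℝ] V →ₗ[ℝ] ℝ)
    (b : OrthonormalBasis ι ℝ V) (c : OrthonormalBasis κ ℝ V) :
    ∑ i, K (b i) (b i) = ∑ j, K (c j) (c j) := by
  let T : V →ₗ[ℝ] V :=
    { toFun := fun v => (InnerProductSpace.toDual ℝ V).symm (K v).toContinuousLinearMap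
      map_add' := by simp
      map_smul' := by simp }
  have hT : ∀ v w, ⟪w, T v⟫ = K v w := fun v w => by
    rw [real_inner_comm]
    exact InnerProductSpace.toDual_symm_apply
  have hb := T.trace_eq_sum_inner b
  have hc := T.trace_eq_sum_inner c
  simp only [hT] at hb hc
  rw [← hb, hc]

/-- A unit vector in a space of dimension `m + 1` is the first vector of an orthonormal basis. -/
theorem exists_orthonormalBasis_apply_zero_eq
    {V : Type*} [NormedAddCommGroup V] [InnerProductSpace ℝ V] [FiniteDimensional ℝ V]
    {m : ℕ} (hdim : Module.finrank ℝ V = m + 1) {v : V} (hv : ‖v‖ = 1) :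
    ∃ c : OrthonormalBasis (Fin (m + 1)) ℝ V, c 0 = v := by
  have hon : Orthonormal ℝ (({0} : Set (Fin (m + 1))).domRestrict fun _ => v) :=
    ⟨fun _ => hv, fun i j hij => (hij (Subsingleton.elim i j)).elim⟩
  obtain ⟨c, hc⟩ := hon.exists_orthonormalBasis_extension_of_card_eq (by simpa using hdim)
  exact ⟨c, hc 0 rfl⟩

/-- If `K` is a symmetric bilinear form on an `n`-dimensional real inner product
space (`n ≥ 2`) such that `Σ K(eⱼ, eⱼ) ≤ -(n-1)` for every orthonormal family
of `n-1` vectors (i.e. `-(K + g)` is `(n-1)`-convex), and `tr K = -n` for some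
orthonormal basis, then `K = -g`. -/
theorem eq_neg_inner_of_trace_eq
    {V : Type*} [NormedAddCommGroup V] [InnerProductSpace ℝ V]
    [FiniteDimensional ℝ V]
    (n : ℕ) (hn : 2 ≤ n) (hdim : Module.finrank ℝ V = n)
    (K : V →ₗ[ℝ] V →ₗ[ℝ] ℝ) (hK : ∀ v w : V, K v w = K w v)
    (hconv : ∀ e : Fin (n - 1) → V, Orthonormal ℝ e →
      ∑ j : Fin (n - 1), K (e j) (e j) ≤ -((n : ℝ) - 1))
    (b : OrthonormalBasis (Fin n) ℝ V)
    (htr : ∑ i : Fin n, K (b i) (b i) = -(n : ℝ)) :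
    ∀ v w : V, K v w = -⟪v, w⟫ := by
  obtain ⟨m, rfl⟩ : ∃ m, n = m + 1 := ⟨n - 1, by omega⟩
  have htrace (c : OrthonormalBasis (Fin (m + 1)) ℝ V) :
      ∑ i, K (c i) (c i) = -((m + 1 : ℕ) : ℝ) :=
    (c.sum_bilin_apply_self_eq K b).trans htr
  have hlower (v : V) (hv : ‖v‖ = 1) : -1 ≤ K v v := by
    obtain ⟨c, rfl⟩ := exists_orthonormalBasis_apply_zero_eq hdim hv
    have hsum : ∑ j : Fin m, K (c j.succ) (c j.succ) ≤ -(((m + 1 : ℕ) : ℝ) - 1) :=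
      hconv (fun j => c (Fin.succ j)) (c.orthonormal.comp _ (Fin.succ_injective m))
    have ht := htrace c
    rw [Fin.sum_univ_succ] at ht
    linarith
  have hunit (v : V) (hv : ‖v‖ = 1) : K v v = -1 := by
    obtain ⟨c, rfl⟩ := exists_orthonormalBasis_apply_zero_eq hdim hv
    have hsum : ∑ i : Fin (m + 1), (-1 : ℝ) = ∑ i, K (c i) (c i) := by
      rw [htrace c]
      simp
    exact ((Finset.sum_eq_sum_iff_of_le fun i _ => hlower _ (c.orthonormal.1 i)).1 hsum 0
      (Finset.mem_univ _)).symm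
  have hself (v : V) : K v v = -⟪v, v⟫ := by
    rcases eq_or_ne v 0 with rfl | hv
    · simp
    · have hu := hunit (‖v‖⁻¹ • v) (norm_smul_inv_norm (𝕜 := ℝ) hv)
      have hn0 : ‖v‖ ≠ 0 := norm_ne_zero_iff.2 hv
      simp only [map_smul, LinearMap.smul_apply, smul_eq_mul] at hu
      rw [real_inner_self_eq_norm_sq]
      field_simp at hu
      linarith
  intro v w
  have h := hself (v + w)
  simp only [map_add, LinearMap.add_apply, inner_add_left, inner_add_right] at h
  linarith [hself v, hself w, hK v w, real_inner_comm v w]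
end

section
/- Let V be an n-dimensional real inner product space with n ≥ 2, and let K be a symmetric bilinear form on V such that for every orthonormal family (e₁, ..., e_{n−1}) of n−1 vectors in V one has Σ_{j=1}^{n−1} K(e_j, e_j) ≤ −(n−1). Let W ⊂ V be an (n−1)-dimensional subspace with unit normal vector ν (so ⟨ν, w⟩ = 0 for all w ∈ W and ‖ν‖ = 1), and suppose that for some orthonormal basis (e₁, ..., e_{n−1}) of W one has Σ_{j=1}^{n−1} K(e_j, e_j) = −(n−1). Then K(ν, w) = 0 for every w ∈ W. -/
open RealInnerProductSpace

/-- Replacing one member of an orthonormal family by a unit vector orthogonal to the others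
gives an orthonormal family. -/
theorem Orthonormal.update_of_inner_eq_zero {V ι : Type*} [NormedAddCommGroup V]
    [InnerProductSpace ℝ V] [DecidableEq ι] {e : ι → V} (he : Orthonormal ℝ e) (i : ι) {u : V}
    (hu : ‖u‖ = 1) (h : ∀ j, j ≠ i → ⟪u, e j⟫ = 0) :
    Orthonormal ℝ (Function.update e i u) := by
  refine ⟨fun j => ?_, fun j k hjk => ?_⟩
  · rcases eq_or_ne j i with rfl | hj
    · simpa using hu
    · simpa [hj] using he.1 j
  · rcases eq_or_ne j i with rfl | hj
    · simpa [hjk.symm] using h k hjk.symm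
    · rcases eq_or_ne k i with rfl | hk
      · simpa [hj, real_inner_comm] using h j hj
      · simpa [hj, hk] using he.2 hjk

/-- If a symmetric bilinear form, restricted to the unit circle of the plane spanned by the
orthonormal pair `v`, `ν`, is maximal at `v`, then it vanishes at `(ν, v)`. -/
theorem LinearMap.apply_eq_zero_of_unit_circle_le {V : Type*} [NormedAddCommGroup V]
    [InnerProductSpace ℝ V] (K : V →ₗ[ℝ] V →ₗ[ℝ] ℝ) (hK : ∀ v w : V, K v w = K w v)
    {v ν : V} (hv : ‖v‖ = 1) (hν : ‖ν‖ = 1) (hperp : ⟪ν, v⟫ = 0)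
    (hmax : ∀ c s : ℝ, ‖c • v + s • ν‖ = 1 →
      K (c • v + s • ν) (c • v + s • ν) ≤ K v v) :
    K ν v = 0 := by
  have key (x : ℝ) : 2 * x * K ν v ≤ K v v - K ν ν := by
    have hsq : ‖x • v + ν‖ ^ 2 = x ^ 2 + 1 := by
      rw [norm_add_sq_real, norm_smul, inner_smul_left, real_inner_comm, hperp, hv, hν]
      simp
    have hpos : 0 < ‖x • v + ν‖ := by
      by_contra! h
      have := le_antisymm h (norm_nonneg _)
      nlinarith [sq_nonneg x]
    set r := ‖x • v + ν‖ with hr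
    have hsum : (r⁻¹ * x) • v + r⁻¹ • ν = r⁻¹ • (x • v + ν) := by
      rw [smul_add, smul_smul]
    have h := hmax (r⁻¹ * x) r⁻¹ (by
      rw [hsum, norm_smul, ← hr, norm_inv, Real.norm_of_nonneg hpos.le,
        inv_mul_cancel₀ hpos.ne'])
    simp only [hsum, map_smul, LinearMap.smul_apply, smul_eq_mul] at h
    have h' := mul_le_mul_of_nonneg_left h (sq_nonneg r)
    rw [show ∀ y : ℝ, r ^ 2 * (r⁻¹ * (r⁻¹ * y)) = y from fun y => by field_simp, hsq] at h'
    simp only [map_smul, map_add, LinearMap.add_apply, LinearMap.smul_apply, smul_eq_mul,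
      hK v ν] at h'
    linarith
  by_contra hb
  have h := key ((K v v - K ν ν + 1) / (2 * K ν v))
  have : 2 * ((K v v - K ν ν + 1) / (2 * K ν v)) * K ν v = K v v - K ν ν + 1 := by
    field_simp
  linarith

/-- Rotation/critical-point rigidity: if `K` is a symmetric bilinear form on an
`n`-dimensional real inner product space (`n ≥ 2`) whose trace over every
`(n-1)`-dimensional subspace is at most `-(n-1)`, and `W` is an
`(n-1)`-dimensional subspace with unit normal `ν` on which the bound is
attained (for some orthonormal basis `e` of `W`), then `K(ν, w) = 0` for every
`w ∈ W`. -/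
theorem normal_contraction_vanishes_of_trace_eq
    {V : Type*} [NormedAddCommGroup V] [InnerProductSpace ℝ V]
    [FiniteDimensional ℝ V]
    (n : ℕ) (hn : 2 ≤ n) (hdim : Module.finrank ℝ V = n)
    (K : V →ₗ[ℝ] V →ₗ[ℝ] ℝ) (hK : ∀ v w : V, K v w = K w v)
    (hconv : ∀ e : Fin (n - 1) → V, Orthonormal ℝ e →
      ∑ j : Fin (n - 1), K (e j) (e j) ≤ -((n : ℝ) - 1))
    (W : Submodule ℝ V) (hW : Module.finrank ℝ W = n - 1)
    (ν : V) (hν : ‖ν‖ = 1) (hperp : ∀ w ∈ W, ⟪ν, w⟫ = 0)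
    (e : Fin (n - 1) → V) (he : Orthonormal ℝ e) (heW : ∀ j, e j ∈ W)
    (heq : ∑ j : Fin (n - 1), K (e j) (e j) = -((n : ℝ) - 1)) :
    ∀ w ∈ W, K ν w = 0 := by
  have hbasis (i : Fin (n - 1)) : K ν (e i) = 0 := by
    refine K.apply_eq_zero_of_unit_circle_le hK (he.1 i) hν (hperp _ (heW i)) fun c s hu => ?_
    have hle := hconv _ (he.update_of_inner_eq_zero i hu fun j hj => by
      rw [inner_add_left, inner_smul_left, inner_smul_left, he.2 hj.symm, hperp _ (heW j)]
      simp)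
    rw [← heq, ← Finset.add_sum_erase _ _ (Finset.mem_univ i),
      ← Finset.add_sum_erase _ (fun j => K (e j) (e j)) (Finset.mem_univ i),
      Finset.sum_congr rfl fun j hj => by
        rw [Function.update_of_ne (Finset.ne_of_mem_erase hj)]] at hle
    simp only [Function.update_self] at hle
    linarith
  have hspan : Submodule.span ℝ (Set.range e) = W := by
    refine Submodule.eq_of_le_of_finrank_eq
      (Submodule.span_le.2 (Set.range_subset_iff.2 heW)) ?_
    rw [finrank_span_eq_card he.linearIndependent, hW, Fintype.card_fin]
  have hker : W ≤ LinearMap.ker (K ν) :=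
    hspan ▸ Submodule.span_le.2 (Set.range_subset_iff.2 hbasis)
  exact fun w hw => hker hw
end
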